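/- arXiv:2402.17530 — 2 statements merged into one kernel-verified Lean document; each statement's English description precedes it below -/
import Mathlib

section
/- Let g be an invertible symmetric real 4×4 matrix with inverse h. Let ℓ_A, ℓ_B ∈ ℝ⁴ be covectors with h(ℓ_A,ℓ_A) = h(ℓ_B,ℓ_B) = 0, and let F_A, F_B be symmetric 4×4 matrices with tr_g F_A = tr_g F_B = 0, (F_A)_{μν} L_A^ν = 0 for every μ, and (F_B)_{μν} L_B^ν = 0 for every μ. Fix ε ∈ {+1, −1} and assume moreover that h(w,w) ≠ 0 where w := ℓ_A + ε ℓ_B. Then the symmetric matrix F^{(2,ε)} := −(1/h(w,w)) 𝓘^{(0,ε)} satisfies 𝒫_w(F^{(2,ε)}) = 𝓘^{(0,ε)}. -/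
open BigOperators

open BigOperators

noncomputable section

/-- `h(v,w) := h^{μν} v_μ w_ν`. -/
def hBil (h : Fin 4 → Fin 4 → ℝ) (v w : Fin 4 → ℝ) : ℝ := ∑ μ, ∑ ν, h μ ν * v μ * w ν

/-- The vector `L^μ := −h^{μν} ℓ_ν` associated to a covector `ℓ`. -/
def vecOf (h : Fin 4 → Fin 4 → ℝ) (ℓ : Fin 4 → ℝ) : Fin 4 → ℝ := fun μ => -∑ ν, h μ ν * ℓ ν

/-- `|P·Q|_g := h^{αβ} h^{μν} P_{αμ} Q_{βν}`. -/
def dotg (h P Q : Fin 4 → Fin 4 → ℝ) : ℝ :=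
  ∑ α, ∑ β, ∑ μ, ∑ ν, h α β * h μ ν * P α μ * Q β ν

/-- `P(X)_α := P_{αμ} X^μ`. -/
def app1 (P : Fin 4 → Fin 4 → ℝ) (X : Fin 4 → ℝ) : Fin 4 → ℝ := fun α => ∑ μ, P α μ * X μ

/-- `P(X,Y) := P_{μν} X^μ Y^ν`. -/
def app2 (P : Fin 4 → Fin 4 → ℝ) (X Y : Fin 4 → ℝ) : ℝ := ∑ μ, ∑ ν, P μ ν * X μ * Y ν

/-- `M(P,Q;X)_β := X^μ P_{μσ} h^{σν} Q_{νβ}`. -/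
def Mop (h P Q : Fin 4 → Fin 4 → ℝ) (X : Fin 4 → ℝ) : Fin 4 → ℝ :=
  fun β => ∑ μ, ∑ σ, ∑ ν, X μ * P μ σ * h σ ν * Q ν β

/-- The quadratic interaction tensor `P^{(0,ε)}`. -/
def P0 (h FA FB : Fin 4 → Fin 4 → ℝ) (ℓA ℓB : Fin 4 → ℝ) (ε : ℝ) : Fin 4 → Fin 4 → ℝ :=
  fun α β =>
    (1 / 4) * ( ε * (ℓA α * Mop h FA FB (vecOf h ℓB) β + ℓA β * Mop h FA FB (vecOf h ℓB) α)
      + ε * (ℓB α * Mop h FB FA (vecOf h ℓA) β + ℓB β * Mop h FB FA (vecOf h ℓA) α)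
      + (ε / 2) * (ℓA α * ℓB β + ℓA β * ℓB α) * dotg h FA FB
      + ε * (app1 FA (vecOf h ℓB) α * app1 FB (vecOf h ℓA) β
           + app1 FA (vecOf h ℓB) β * app1 FB (vecOf h ℓA) α)
      - ε * hBil h ℓA ℓB * (∑ σ, ∑ ν, h σ ν * (FA α σ * FB ν β + FA β σ * FB ν α)) )

/-- The covector `J` appearing in `𝓘^{(0,ε)}`. -/
def Jcov (h FA FB : Fin 4 → Fin 4 → ℝ) (ℓA ℓB : Fin 4 → ℝ) (ε : ℝ) : Fin 4 → ℝ :=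
  fun β => -(1 / 8) * dotg h FA FB * (ℓA β + ε * ℓB β)
    - (1 / 4) * Mop h FB FA (vecOf h ℓA) β
    - (ε / 4) * Mop h FA FB (vecOf h ℓB) β

/-- The interaction source tensor `𝓘^{(0,ε)}`. -/
def Icor (h FA FB : Fin 4 → Fin 4 → ℝ) (ℓA ℓB : Fin 4 → ℝ) (ε : ℝ) : Fin 4 → Fin 4 → ℝ :=
  fun α β =>
    -(1 / 4) * (app2 FB (vecOf h ℓA) (vecOf h ℓA) * FA α β
            + app2 FA (vecOf h ℓB) (vecOf h ℓB) * FB α β)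
    + P0 h FA FB ℓA ℓB ε α β
    + (ℓA α + ε * ℓB α) * Jcov h FA FB ℓA ℓB ε β
    + (ℓA β + ε * ℓB β) * Jcov h FA FB ℓA ℓB ε α

/-- The polarization covector `Pol(S,v)_α = h^{μν} S_{αμ} v_ν − (1/2)(tr_g S) v_α`. -/
def Pol (h S : Fin 4 → Fin 4 → ℝ) (v : Fin 4 → ℝ) : Fin 4 → ℝ :=
  fun α => (∑ μ, ∑ ν, h μ ν * S α μ * v ν)
    - (1 / 2) * (∑ μ, ∑ ν, h μ ν * S μ ν) * v α

end


/-- The operator `𝒫_v(S)_{αβ} = −h(v,v) S_{αβ} + v_α Pol(S,v)_β + v_β Pol(S,v)_α`. -/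
noncomputable def Pv (h : Fin 4 → Fin 4 → ℝ) (v : Fin 4 → ℝ) (S : Fin 4 → Fin 4 → ℝ) :
    Fin 4 → Fin 4 → ℝ :=
  fun α β => -(hBil h v v) * S α β + v α * Pol h S v β + v β * Pol h S v α

open Matrix

section MatrixForms

variable (h P Q : Matrix (Fin 4) (Fin 4) ℝ) (v w : Fin 4 → ℝ)

theorem hBil_eq_dotProduct : hBil h v w = v ⬝ᵥ h *ᵥ w := by
  simp only [hBil, dotProduct, mulVec, Finset.mul_sum]
  exact Finset.sum_congr rfl fun _ _ => Finset.sum_congr rfl fun _ _ => by ring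

theorem vecOf_eq_mulVec : vecOf h v = -(h *ᵥ v) := rfl

theorem app1_eq_mulVec : app1 P v = P *ᵥ v := rfl

theorem app2_eq_dotProduct : app2 P v w = v ⬝ᵥ P *ᵥ w := hBil_eq_dotProduct P v w

theorem Mop_eq_vecMul : Mop h P Q v = v ᵥ* P ᵥ* h ᵥ* Q := by
  ext β
  simp only [Mop, vecMul, dotProduct, Fin.sum_univ_four]
  ring

theorem sum_mul_eq_trace : ∑ μ, ∑ ν, h μ ν * P μ ν = (hᵀ * P).trace := by
  simp only [trace, diag_apply, mul_apply, transpose_apply]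
  exact Finset.sum_comm

theorem dotg_eq_trace : dotg h P Q = (hᵀ * (P * h * Qᵀ)).trace := by
  rw [← sum_mul_eq_trace]
  simp only [dotg, mul_apply, transpose_apply, Finset.mul_sum, Finset.sum_mul]
  refine Finset.sum_congr rfl fun _ _ => Finset.sum_congr rfl fun _ _ => ?_
  rw [Finset.sum_comm]
  exact Finset.sum_congr rfl fun _ _ => Finset.sum_congr rfl fun _ _ => by ring

theorem sum_mul_mul_eq_mul_apply (α β : Fin 4) :
    ∑ σ, ∑ ν, h σ ν * (P α σ * Q ν β + P β σ * Q ν α)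
      = (P * h * Q + (P * h * Q)ᵀ) α β := by
  simp only [Matrix.add_apply, transpose_apply, mul_apply, Fin.sum_univ_four]
  ring

theorem Pol_eq_mulVec :
    Pol h P v = P *ᵥ (h *ᵥ v) - (1 / 2 * (hᵀ * P).trace) • v := by
  ext α
  rw [← sum_mul_eq_trace]
  simp only [Pol, Pi.sub_apply, Pi.smul_apply, smul_eq_mul, mulVec, dotProduct, Finset.mul_sum]
  congr 1
  exact Finset.sum_congr rfl fun _ _ => Finset.sum_congr rfl fun _ _ => by ring

end MatrixForms

/-- The symmetrized product `v_α w_β + v_β w_α` of two covectors. -/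
def symProd (v w : Fin 4 → ℝ) : Matrix (Fin 4) (Fin 4) ℝ := vecMulVec v w + vecMulVec w v

theorem symProd_mulVec (v w u : Fin 4 → ℝ) :
    symProd v w *ᵥ u = (w ⬝ᵥ u) • v + (v ⬝ᵥ u) • w := by
  simp [symProd, add_mulVec, vecMulVec_mulVec]

theorem trace_mul_symProd {h : Matrix (Fin 4) (Fin 4) ℝ} (hh : hᵀ = h) (v w : Fin 4 → ℝ) :
    (h * symProd v w).trace = 2 * (v ⬝ᵥ h *ᵥ w) := by
  have key : w ⬝ᵥ h *ᵥ v = v ⬝ᵥ h *ᵥ w := by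
    rw [dotProduct_mulVec, ← mulVec_transpose, hh, dotProduct_comm]
  simp only [symProd, mul_add, trace_add, mul_vecMulVec, trace_vecMulVec]
  rw [dotProduct_comm _ w, dotProduct_comm _ v, key]
  ring

theorem Icor_eq {h A B : Matrix (Fin 4) (Fin 4) ℝ} (hh : hᵀ = h) (hA : Aᵀ = A) (hB : Bᵀ = B)
    (a b : Fin 4 → ℝ) (ε : ℝ) :
    Icor h A B a b ε =
      -(1 / 4 : ℝ) • ((h *ᵥ a ⬝ᵥ B *ᵥ (h *ᵥ a)) • A + (h *ᵥ b ⬝ᵥ A *ᵥ (h *ᵥ b)) • B)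
      + (ε / 4) • (-symProd a (B *ᵥ (h *ᵥ (A *ᵥ (h *ᵥ b))))
          - symProd b (A *ᵥ (h *ᵥ (B *ᵥ (h *ᵥ a))))
          + (1 / 2 * (h * (A * h * B)).trace) • symProd a b
          + symProd (A *ᵥ (h *ᵥ b)) (B *ᵥ (h *ᵥ a))
          - (a ⬝ᵥ h *ᵥ b) • (A * h * B + B * h * A))
      + symProd (a + ε • b) (-(1 / 8 * (h * (A * h * B)).trace) • (a + ε • b)
          + (1 / 4 : ℝ) • (A *ᵥ (h *ᵥ (B *ᵥ (h *ᵥ a))))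
          + (ε / 4) • (B *ᵥ (h *ᵥ (A *ᵥ (h *ᵥ b))))) := by
  have hN : (A * h * B)ᵀ = B * h * A := by
    rw [transpose_mul, transpose_mul, hA, hB, hh, Matrix.mul_assoc]
  have tA (u : Fin 4 → ℝ) : u ᵥ* A = A *ᵥ u := by rw [← mulVec_transpose, hA]
  have tB (u : Fin 4 → ℝ) : u ᵥ* B = B *ᵥ u := by rw [← mulVec_transpose, hB]
  have th (u : Fin 4 → ℝ) : u ᵥ* h = h *ᵥ u := by rw [← mulVec_transpose, hh]
  ext α β
  simp only [Icor, P0, Jcov, sum_mul_mul_eq_mul_apply, hBil_eq_dotProduct, vecOf_eq_mulVec,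
    app1_eq_mulVec, app2_eq_dotProduct, Mop_eq_vecMul, dotg_eq_trace, hN, hh, hB, tA, tB, th,
    mulVec_neg, neg_dotProduct, dotProduct_neg, symProd, Matrix.add_apply,
    Matrix.sub_apply, Matrix.neg_apply, Matrix.smul_apply, vecMulVec_apply,
    Pi.add_apply, Pi.neg_apply, Pi.smul_apply, smul_eq_mul]
  ring

theorem Pol_Icor_eq_zero {h A B : Matrix (Fin 4) (Fin 4) ℝ} (hh : hᵀ = h) (hA : Aᵀ = A)
    (hB : Bᵀ = B) {a b : Fin 4 → ℝ} (ha : a ⬝ᵥ h *ᵥ a = 0) (hb : b ⬝ᵥ h *ᵥ b = 0)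
    (trA : (h * A).trace = 0) (trB : (h * B).trace = 0)
    (Aa : A *ᵥ (h *ᵥ a) = 0) (Bb : B *ᵥ (h *ᵥ b) = 0) {ε : ℝ} (hε : ε * ε = 1) :
    Pol h (Icor h A B a b ε) (a + ε • b) = 0 := by
  have comm {S : Matrix (Fin 4) (Fin 4) ℝ} (hS : Sᵀ = S) (v w : Fin 4 → ℝ) :
      v ⬝ᵥ S *ᵥ w = w ⬝ᵥ S *ᵥ v := by
    rw [dotProduct_mulVec, ← mulVec_transpose, hS, dotProduct_comm]
  have trN : (h * (B * h * A)).trace = (h * (A * h * B)).trace := by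
    rw [Matrix.mul_assoc B, ← Matrix.mul_assoc h B, trace_mul_comm]
    simp only [Matrix.mul_assoc]
  have adj {S : Matrix (Fin 4) (Fin 4) ℝ} (hS : Sᵀ = S) (v w : Fin 4 → ℝ) :
      (S *ᵥ v) ⬝ᵥ (h *ᵥ w) = v ⬝ᵥ S *ᵥ (h *ᵥ w) := by
    rw [dotProduct_comm, comm hS]
  have hx : (A *ᵥ (h *ᵥ b)) ⬝ᵥ (h *ᵥ a) = 0 := by rw [adj hA, Aa, dotProduct_zero]
  have hy : (B *ᵥ (h *ᵥ a)) ⬝ᵥ (h *ᵥ b) = 0 := by rw [adj hB, Bb, dotProduct_zero]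
  have hpa : (B *ᵥ (h *ᵥ (A *ᵥ (h *ᵥ b)))) ⬝ᵥ (h *ᵥ a)
      = (A *ᵥ (h *ᵥ b)) ⬝ᵥ h *ᵥ (B *ᵥ (h *ᵥ a)) := by
    rw [adj hB, dotProduct_comm, comm hh, dotProduct_comm, dotProduct_comm]
  have hpb : (B *ᵥ (h *ᵥ (A *ᵥ (h *ᵥ b)))) ⬝ᵥ (h *ᵥ b) = 0 := by
    rw [adj hB, Bb, dotProduct_zero]
  have hqb : (A *ᵥ (h *ᵥ (B *ᵥ (h *ᵥ a)))) ⬝ᵥ (h *ᵥ b)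
      = (A *ᵥ (h *ᵥ b)) ⬝ᵥ h *ᵥ (B *ᵥ (h *ᵥ a)) := by
    rw [adj hA, dotProduct_comm]
  have hqa : (A *ᵥ (h *ᵥ (B *ᵥ (h *ᵥ a)))) ⬝ᵥ (h *ᵥ a) = 0 := by
    rw [adj hA, Aa, dotProduct_zero]
  have hba : b ⬝ᵥ h *ᵥ a = a ⬝ᵥ h *ᵥ b := comm hh b a
  have hα : (A *ᵥ (h *ᵥ b)) ⬝ᵥ (h *ᵥ b) = h *ᵥ b ⬝ᵥ A *ᵥ (h *ᵥ b) := dotProduct_comm _ _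
  have hβ : (B *ᵥ (h *ᵥ a)) ⬝ᵥ (h *ᵥ a) = h *ᵥ a ⬝ᵥ B *ᵥ (h *ᵥ a) := dotProduct_comm _ _
  refine (congrArg (Pol h · (a + ε • b)) (Icor_eq hh hA hB a b ε)).trans
    ((Pol_eq_mulVec h _ _).trans ?_)
  rw [hh]
  simp only [mul_add, mul_sub, mul_neg, Matrix.mul_smul, trace_add, trace_sub, trace_neg,
    trace_smul, trace_mul_symProd hh, trA, trB, trN]
  simp only [comm hh a (B *ᵥ _), comm hh b (A *ᵥ _), comm hh (a + ε • b)]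
  simp only [add_mulVec, sub_mulVec, neg_mulVec, smul_mulVec, symProd_mulVec, ← mulVec_mulVec,
    mulVec_add, mulVec_smul, mulVec_zero, Aa, Bb, add_dotProduct, dotProduct_add, smul_dotProduct,
    dotProduct_smul, ha, hb, hba, hx, hy, hpa, hpb, hqa, hqb, hα, hβ, smul_eq_mul]
  generalize A *ᵥ (h *ᵥ (B *ᵥ (h *ᵥ a))) = q
  generalize B *ᵥ (h *ᵥ (A *ᵥ (h *ᵥ b))) = p
  ext i
  simp only [Pi.add_apply, Pi.sub_apply, Pi.neg_apply, Pi.smul_apply, Pi.zero_apply, smul_eq_mul]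
  rcases mul_self_eq_one_iff.mp hε with rfl | rfl <;> ring

theorem Pol_smul (h S : Fin 4 → Fin 4 → ℝ) (c : ℝ) (v : Fin 4 → ℝ) :
    Pol h (fun α β => c * S α β) v = c • Pol h S v := by
  ext α
  simp only [Pol, Fin.sum_univ_four, Pi.smul_apply, smul_eq_mul]
  ring

theorem transpose_eq_of_inverse {g h : Matrix (Fin 4) (Fin 4) ℝ} (hg : ∀ i j, g i j = g j i)
    (hgh : ∀ i j, (∑ k, g i k * h k j) = if i = j then (1 : ℝ) else 0) : hᵀ = h := by
  have hmul : g * h = 1 := by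
    ext i j
    rw [mul_apply, one_apply, hgh]
  have hmul' : hᵀ * g = 1 := by
    rw [← (Matrix.ext fun i j => hg j i : gᵀ = g), ← transpose_mul, hmul, transpose_one]
  exact left_inv_eq_right_inv hmul' hmul

theorem trace_mul_eq_zero {h F : Matrix (Fin 4) (Fin 4) ℝ} (hh : hᵀ = h)
    (hF : (∑ μ, ∑ ν, h μ ν * F μ ν) = 0) : (h * F).trace = 0 := by
  rw [← hF, sum_mul_eq_trace, hh]

theorem mulVec_mulVec_eq_zero {h F : Matrix (Fin 4) (Fin 4) ℝ} {l : Fin 4 → ℝ}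
    (hF : ∀ μ, (∑ ν, F μ ν * vecOf h l ν) = 0) : F *ᵥ (h *ᵥ l) = 0 := by
  have hF' : F *ᵥ vecOf h l = 0 := funext hF
  rwa [vecOf_eq_mulVec, mulVec_neg, neg_eq_zero] at hF'

/-- if moreover `h(w,w) ≠ 0` with `w = ℓ_A + ε ℓ_B`, then
`F^{(2,ε)} := −(1/h(w,w)) 𝓘^{(0,ε)}` satisfies `𝒫_w(F^{(2,ε)}) = 𝓘^{(0,ε)}`. -/
theorem statement6
    (g h : Fin 4 → Fin 4 → ℝ)
    (hg_symm : ∀ α β, g α β = g β α)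
    (h_inv₁ : ∀ α β, (∑ σ, g α σ * h σ β) = if α = β then (1 : ℝ) else 0)
    (h_inv₂ : ∀ α β, (∑ σ, h α σ * g σ β) = if α = β then (1 : ℝ) else 0)
    (ℓA ℓB : Fin 4 → ℝ)
    (hnullA : hBil h ℓA ℓA = 0) (hnullB : hBil h ℓB ℓB = 0)
    (FA FB : Fin 4 → Fin 4 → ℝ)
    (hFA_symm : ∀ α β, FA α β = FA β α) (hFB_symm : ∀ α β, FB α β = FB β α)
    (hFA_tr : (∑ μ, ∑ ν, h μ ν * FA μ ν) = 0)
    (hFB_tr : (∑ μ, ∑ ν, h μ ν * FB μ ν) = 0)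
    (hFA_trans : ∀ μ, (∑ ν, FA μ ν * vecOf h ℓA ν) = 0)
    (hFB_trans : ∀ μ, (∑ ν, FB μ ν * vecOf h ℓB ν) = 0)
    (ε : ℝ) (hε : ε = 1 ∨ ε = -1)
    (hw : hBil h (fun β => ℓA β + ε * ℓB β) (fun β => ℓA β + ε * ℓB β) ≠ 0) :
    ∀ α β,
      Pv h (fun β => ℓA β + ε * ℓB β)
        (fun α β => -(1 / hBil h (fun β => ℓA β + ε * ℓB β) (fun β => ℓA β + ε * ℓB β))
          * Icor h FA FB ℓA ℓB ε α β) α β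
      = Icor h FA FB ℓA ℓB ε α β := by
  intro α β
  have hh := transpose_eq_of_inverse (g := g) (h := h) hg_symm h_inv₁
  have hPol : Pol h (Icor h FA FB ℓA ℓB ε) (fun β => ℓA β + ε * ℓB β) = 0 :=
    Pol_Icor_eq_zero hh (Matrix.ext fun i j => hFA_symm j i) (Matrix.ext fun i j => hFB_symm j i)
      ((hBil_eq_dotProduct h ℓA ℓA).symm.trans hnullA)
      ((hBil_eq_dotProduct h ℓB ℓB).symm.trans hnullB)
      (trace_mul_eq_zero hh hFA_tr) (trace_mul_eq_zero hh hFB_tr)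
      (mulVec_mulVec_eq_zero hFA_trans) (mulVec_mulVec_eq_zero hFB_trans)
      (mul_self_eq_one_iff.mpr hε)
  simp only [Pv, Pol_smul, hPol, smul_zero, Pi.zero_apply, mul_zero, add_zero]
  field_simp
end

section
/- Let g be a positive definite symmetric real 3×3 matrix with inverse h, let ω_A, ω_B ∈ ℝ³ be nonzero covectors, fix ε ∈ {+1, −1}, and let F̄_A, F̄_B be symmetric 3×3 matrices with h^{ij} (F̄_A)_{ij} = 0 and (F̄_A)_{ij} h^{jk} (ω_A)_k = 0 for all i, and likewise h^{ij} (F̄_B)_{ij} = 0 and (F̄_B)_{ij} h^{jk} (ω_B)_k = 0. Write |ω| := √(h^{ij} ω_i ω_j), and assume ω_A + ε ω_B ≠ 0 and h^{ij}(ω_A)_i (ω_B)_j ≠ |ω_A| |ω_B|. Let ℓ_A := (|ω_A|, ω_A) and ℓ_B := (|ω_B|, ω_B) as 4-covectors (which satisfy 𝐡(ℓ_A,ℓ_A) = 𝐡(ℓ_B,ℓ_B) = 0), let F_A, F_B be the symmetric 4×4 extensions of F̄_A, F̄_B by zero (so (F_A)_{0α} = 0, etc.), let 𝓘 := 𝓘^{(0,ε)}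 be the associated symmetric 4×4 matrix, and set w := ℓ_A + ε ℓ_B, for which 𝐡(w,w) = 2ε( h^{ij}(ω_A)_i(ω_B)_j − |ω_A||ω_B| ) ≠ 0. Define φ̂^{(2,ε)} := ( |F̄_A·F̄_B|_h / (64 |ω_A + ε ω_B|²) )·( 2|ω_A|² + 2|ω_B|² + 3ε h^{ij}(ω_A)_i(ω_B)_j − ε |ω_A||ω_B| ) − ε ( (F̄_A)_{ib} h^{bc} (ω_B)_c · h^{ij} · (F̄_B)_{jd} h^{de} (ω_A)_e ) / (32 |ω_A + ε ω_B|²), where |F̄_A·F̄_B|_h := h^{ik} h^{jl} (F̄_A)_{ij} (F̄_B)_{kl}. Define γ_{ij} := −𝓘_{ij}/𝐡(w,w) − 4 φ̂^{(2,ε)} g_{ij} and N_w^i := h^{ij}(ω_A + ε ω_B)_j / |ω_A + ε ω_B|. Then tr γ = (N_w)^i (N_w)^j γ_{ij}; equivalently P̄¹_{N_w}(γ) = γ, so that the spatial matrix F^{(2,ε)}_{ij} := −𝓘_{ij}/𝐡(w,w) decomposes as F^{(2,ε)}_{ij} = P̄¹_{N_w}(γ)_{ij} + 4 φ̂^{(2,ε)}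 g_{ij}. -/
open BigOperators

noncomputable section

/-- The block 4×4 matrix with `00`-entry `a`, `0i`- and `i0`-entries `b i`, and
spatial block `m`. -/
def blk (a : ℝ) (b : Fin 3 → ℝ) (m : Fin 3 → Fin 3 → ℝ) : Fin 4 → Fin 4 → ℝ :=
  fun μ ν =>
    if hμ : μ = 0 then
      (if hν : ν = 0 then a else b (ν.pred hν))
    else
      (if hν : ν = 0 then b (μ.pred hμ) else m (μ.pred hμ) (ν.pred hν))

/-- The 4-covector with time component `a` and spatial components `ω`. -/
def cov4 (a : ℝ) (ω : Fin 3 → ℝ) : Fin 4 → ℝ :=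
  fun μ => if hμ : μ = 0 then a else ω (μ.pred hμ)

/-- `|ω| := √(h^{ij} ω_i ω_j)` (3-dimensional). -/
def nrm3 (h : Fin 3 → Fin 3 → ℝ) (ω : Fin 3 → ℝ) : ℝ :=
  Real.sqrt (∑ i, ∑ j, h i j * ω i * ω j)

/-- `h^{ij} v_i w_j` (3-dimensional). -/
def dot3 (h : Fin 3 → Fin 3 → ℝ) (v w : Fin 3 → ℝ) : ℝ := ∑ i, ∑ j, h i j * v i * w j

/-- The zero extension of a spatial matrix to a 4×4 matrix. -/
def ext0 (m : Fin 3 → Fin 3 → ℝ) : Fin 4 → Fin 4 → ℝ := blk 0 (fun _ => 0) m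

/-- The inverse block Lorentzian metric `𝐡` built from `h`. -/
def bigH (h : Fin 3 → Fin 3 → ℝ) : Fin 4 → Fin 4 → ℝ := blk (-1) (fun _ => 0) h

/-- The null covector `ℓ := (|ω|, ω)`. -/
def ell (h : Fin 3 → Fin 3 → ℝ) (ω : Fin 3 → ℝ) : Fin 4 → ℝ := cov4 (nrm3 h ω) ω

/-- The spatial covector `w̄ := ω_A + ε ω_B`. -/
def wbar (ωA ωB : Fin 3 → ℝ) (ε : ℝ) : Fin 3 → ℝ := fun i => ωA i + ε * ωB i

/-- The 4-covector `w := ℓ_A + ε ℓ_B`. -/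
def wcov (h : Fin 3 → Fin 3 → ℝ) (ωA ωB : Fin 3 → ℝ) (ε : ℝ) : Fin 4 → ℝ :=
  fun μ => ell h ωA μ + ε * ell h ωB μ

/-- The tensor `𝓘^{(0,ε)}` built from `(g, h, ω_A, ω_B, F̄_A, F̄_B, ε)` after the 3+1 lift. -/
def I12 (h FbA FbB : Fin 3 → Fin 3 → ℝ) (ωA ωB : Fin 3 → ℝ) (ε : ℝ) :
    Fin 4 → Fin 4 → ℝ :=
  Icor (bigH h) (ext0 FbA) (ext0 FbB) (ell h ωA) (ell h ωB) ε

/-- `𝐡(w,w)` for `w = ℓ_A + ε ℓ_B`. -/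
def Hww (h : Fin 3 → Fin 3 → ℝ) (ωA ωB : Fin 3 → ℝ) (ε : ℝ) : ℝ :=
  hBil (bigH h) (wcov h ωA ωB ε) (wcov h ωA ωB ε)

/-- The scalar `φ̂^{(2,ε)}`. -/
def phi2 (h FbA FbB : Fin 3 → Fin 3 → ℝ) (ωA ωB : Fin 3 → ℝ) (ε : ℝ) : ℝ :=
  ((∑ i, ∑ k, ∑ j, ∑ l, h i k * h j l * FbA i j * FbB k l)
      / (64 * (nrm3 h (wbar ωA ωB ε)) ^ 2))
    * (2 * (nrm3 h ωA) ^ 2 + 2 * (nrm3 h ωB) ^ 2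
      + 3 * ε * dot3 h ωA ωB - ε * (nrm3 h ωA) * (nrm3 h ωB))
  - ε * (∑ i, ∑ b, ∑ c, ∑ j, ∑ d, ∑ e,
        FbA i b * h b c * ωB c * h i j * FbB j d * h d e * ωA e)
      / (32 * (nrm3 h (wbar ωA ωB ε)) ^ 2)

/-- The unit vector `N_w^i := h^{ij} w̄_j / |w̄|`. -/
def Nw (h : Fin 3 → Fin 3 → ℝ) (ωA ωB : Fin 3 → ℝ) (ε : ℝ) : Fin 3 → ℝ :=
  fun i => (∑ j, h i j * wbar ωA ωB ε j) / nrm3 h (wbar ωA ωB ε)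

/-- `γ_{ij} := −𝓘_{ij}/𝐡(w,w) − 4 φ̂^{(2,ε)} g_{ij}`. -/
def gam (g h FbA FbB : Fin 3 → Fin 3 → ℝ) (ωA ωB : Fin 3 → ℝ) (ε : ℝ) :
    Fin 3 → Fin 3 → ℝ :=
  fun i j => -(I12 h FbA FbB ωA ωB ε i.succ j.succ) / Hww h ωA ωB ε
    - 4 * phi2 h FbA FbB ωA ωB ε * g i j

/-- `tr S := h^{ij} S_{ij}` (3-dimensional). -/
def trH (h S : Fin 3 → Fin 3 → ℝ) : ℝ := ∑ i, ∑ j, h i j * S i j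

/-- `S_{NN} := N^i N^j S_{ij}`. -/
def quadN (N : Fin 3 → ℝ) (S : Fin 3 → Fin 3 → ℝ) : ℝ := ∑ i, ∑ j, N i * N j * S i j

/-- The operator `P̄¹_N(S)_{ij} := S_{ij} − (1/2)(tr S − S_{NN}) g_{ij}`. -/
def P1 (g h : Fin 3 → Fin 3 → ℝ) (N : Fin 3 → ℝ) (S : Fin 3 → Fin 3 → ℝ) :
    Fin 3 → Fin 3 → ℝ :=
  fun i j => S i j - (1 / 2) * (trH h S - quadN N S) * g i j

end

section Block

variable (a : ℝ) (b : Fin 3 → ℝ) (m : Fin 3 → Fin 3 → ℝ) (i j : Fin 3)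

lemma blk_zero_zero : blk a b m 0 0 = a := by simp [blk]

lemma blk_zero_succ : blk a b m 0 j.succ = b j := by simp [blk, Fin.succ_ne_zero]

lemma blk_succ_zero : blk a b m i.succ 0 = b i := by simp [blk, Fin.succ_ne_zero]

lemma blk_succ_succ : blk a b m i.succ j.succ = m i j := by simp [blk, Fin.succ_ne_zero]

lemma cov4_zero : cov4 a b 0 = a := by simp [cov4]

lemma cov4_succ : cov4 a b i.succ = b i := by simp [cov4, Fin.succ_ne_zero]

end Block

lemma sum_fin_four_eq_zero_add_succ (f : Fin 4 → ℝ) : ∑ μ, f μ = f 0 + ∑ i : Fin 3, f i.succ :=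
  Fin.sum_univ_succ f

/-- The contraction `F_{ij} x^j`. -/
def contract (F : Fin 3 → Fin 3 → ℝ) (x : Fin 3 → ℝ) : Fin 3 → ℝ := fun i => ∑ j, F i j * x j

/-- The symmetrized tensor product `p_i q_j + p_j q_i`. -/
def symOuter (p q : Fin 3 → ℝ) : Fin 3 → Fin 3 → ℝ := fun i j => p i * q j + p j * q i

/-- The symmetrized product `h^{kl} (A_{ik} B_{lj} + A_{jk} B_{li})`. -/
def symComp (h A B : Fin 3 → Fin 3 → ℝ) : Fin 3 → Fin 3 → ℝ :=
  fun i j => ∑ k, ∑ l, h k l * (A i k * B l j + A j k * B l i)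

/-- The scalar product `h^{ik} h^{jl} A_{ij} B_{kl}`. -/
def dotMat (h A B : Fin 3 → Fin 3 → ℝ) : ℝ :=
  ∑ i, ∑ k, ∑ j, ∑ l, h i k * h j l * A i j * B k l

section Linear

variable (h S T A B : Fin 3 → Fin 3 → ℝ) (N p q : Fin 3 → ℝ) (c : ℝ)

lemma trH_add : trH h (S + T) = trH h S + trH h T := by
  simp [trH, mul_add, Finset.sum_add_distrib]

lemma trH_smul : trH h (c • S) = c * trH h S := by
  simp [trH, Finset.mul_sum, mul_left_comm]

lemma quadN_add : quadN N (S + T) = quadN N S + quadN N T := by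
  simp [quadN, mul_add, Finset.sum_add_distrib]

lemma quadN_smul : quadN N (c • S) = c * quadN N S := by
  simp [quadN, Finset.mul_sum, mul_left_comm]

lemma quadN_div : quadN (fun i => N i / c) S = quadN N S / c ^ 2 := by
  simp only [quadN, Finset.sum_div]
  refine Finset.sum_congr rfl fun i _ => Finset.sum_congr rfl fun j _ => ?_
  rw [div_mul_div_comm, ← sq, div_mul_eq_mul_div]

lemma quadN_eq_dotProduct : quadN N S = N ⬝ᵥ contract S N := by
  simp only [quadN, contract, dotProduct, Finset.mul_sum]
  exact Finset.sum_congr rfl fun i _ => Finset.sum_congr rfl fun j _ => by ring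

lemma quadN_symOuter : quadN N (symOuter p q) = 2 * ((N ⬝ᵥ p) * (N ⬝ᵥ q)) := by
  simp only [quadN, symOuter, dotProduct, Fin.sum_univ_three]
  ring

lemma dot3_eq_dotProduct : dot3 h p q = p ⬝ᵥ contract h q := by
  simp only [dot3, contract, dotProduct, Finset.mul_sum]
  exact Finset.sum_congr rfl fun i _ => Finset.sum_congr rfl fun j _ => by ring

variable {h A B}

lemma dot3_comm (hh : ∀ i j, h i j = h j i) : dot3 h p q = dot3 h q p := by
  unfold dot3
  rw [Finset.sum_comm]
  exact Finset.sum_congr rfl fun i _ => Finset.sum_congr rfl fun j _ => by rw [hh j i]; ring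

lemma dot3_eq_contract_dotProduct (hh : ∀ i j, h i j = h j i) :
    dot3 h p q = contract h p ⬝ᵥ q := by
  rw [dot3_comm p q hh, dot3_eq_dotProduct, dotProduct_comm]

lemma trH_symOuter (hh : ∀ i j, h i j = h j i) : trH h (symOuter p q) = 2 * dot3 h p q := by
  have : trH h (symOuter p q) = dot3 h p q + dot3 h q p := by
    simp only [trH, symOuter, dot3, ← Finset.sum_add_distrib]
    exact Finset.sum_congr rfl fun i _ => Finset.sum_congr rfl fun j _ => by ring
  rw [this, dot3_comm q p hh]
  ring

lemma dotProduct_contract_comm (hA : ∀ i j, A i j = A j i) :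
    p ⬝ᵥ contract A q = q ⬝ᵥ contract A p := by
  rw [← dot3_eq_dotProduct, ← dot3_eq_dotProduct, dot3_comm p q hA]

lemma quadN_symComp (hA : ∀ i j, A i j = A j i) (hB : ∀ i j, B i j = B j i) :
    quadN N (symComp h A B) = 2 * dot3 h (contract A N) (contract B N) := by
  simp only [quadN, symComp, dot3, contract, Fin.sum_univ_three,
    hA 1 0, hA 2 0, hA 2 1, hB 1 0, hB 2 0, hB 2 1]
  ring

lemma trH_symComp (hh : ∀ i j, h i j = h j i)
    (hA : ∀ i j, A i j = A j i) (hB : ∀ i j, B i j = B j i) :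
    trH h (symComp h A B) = 2 * dotMat h A B := by
  simp only [trH, symComp, dotMat, Fin.sum_univ_three, hh 1 0, hh 2 0, hh 2 1,
    hA 1 0, hA 2 0, hA 2 1, hB 1 0, hB 2 0, hB 2 1]
  ring

lemma contract_add_smul (y : Fin 3 → ℝ) (x : Fin 3 → ℝ) :
    contract A (x + c • y) = contract A x + c • contract A y := by
  funext i
  simp [contract, mul_add, Finset.sum_add_distrib, Finset.mul_sum, mul_left_comm]

end Linear

section Inverse

variable {g h : Fin 3 → Fin 3 → ℝ}

lemma contract_contract_of_inv
    (h_inv : ∀ i j, (∑ k, g i k * h k j) = if i = j then (1 : ℝ) else 0) (x : Fin 3 → ℝ) :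
    contract g (contract h x) = x := by
  funext i
  simp only [contract, Finset.mul_sum]
  rw [Finset.sum_comm]
  simp only [← mul_assoc, ← Finset.sum_mul, h_inv, ite_mul, one_mul, zero_mul]
  simp

lemma inv_symm (hg : ∀ i j, g i j = g j i)
    (h_inv₁ : ∀ i j, (∑ k, g i k * h k j) = if i = j then (1 : ℝ) else 0) (i j : Fin 3) :
    h i j = h j i := by
  let G : Matrix (Fin 3) (Fin 3) ℝ := Matrix.of g
  let H : Matrix (Fin 3) (Fin 3) ℝ := Matrix.of h
  have hGH : G * H = 1 := by
    ext i j
    simp [G, H, Matrix.mul_apply, h_inv₁, Matrix.one_apply]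
  have hG : G.transpose = G := by
    ext i j
    exact hg j i
  have hH : H.transpose * G = 1 := by
    rw [← hG, ← Matrix.transpose_mul, hGH, Matrix.transpose_one]
  have : H.transpose = H := left_inv_eq_right_inv hH hGH
  exact congrFun (congrFun this j) i

lemma dot3_self_pos (hg : ∀ i j, g i j = g j i)
    (hg_pos : ∀ ξ : Fin 3 → ℝ, ξ ≠ 0 → 0 < ∑ i, ∑ j, g i j * ξ i * ξ j)
    (h_inv₁ : ∀ i j, (∑ k, g i k * h k j) = if i = j then (1 : ℝ) else 0)
    {x : Fin 3 → ℝ} (hx : x ≠ 0) : 0 < dot3 h x x := by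
  have hgh := contract_contract_of_inv h_inv₁ x
  have hne : contract h x ≠ 0 := by
    intro h0
    apply hx
    rw [← hgh, h0]
    funext i
    simp [contract]
  have := hg_pos _ hne
  change 0 < dot3 g _ _ at this
  rwa [dot3_eq_contract_dotProduct _ _ hg, hgh, ← dot3_eq_dotProduct] at this

lemma nrm3_sq {x : Fin 3 → ℝ} (hx : 0 < dot3 h x x) : nrm3 h x ^ 2 = dot3 h x x :=
  Real.sq_sqrt hx.le

end Inverse

section Spatial

variable {h A B : Fin 3 → Fin 3 → ℝ} (a b : Fin 3 → ℝ) (ε : ℝ)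

lemma Hww_eq (ha : nrm3 h a ^ 2 = dot3 h a a) (hb : nrm3 h b ^ 2 = dot3 h b b)
    (hh : ∀ i j, h i j = h j i) :
    Hww h a b ε = 2 * ε * (dot3 h a b - nrm3 h a * nrm3 h b) := by
  have key : Hww h a b ε = -(nrm3 h a + ε * nrm3 h b) ^ 2 +
      dot3 h (a + ε • b) (a + ε • b) := by
    simp only [Hww, hBil, wcov, ell, bigH, sum_fin_four_eq_zero_add_succ, blk_zero_zero,
      blk_zero_succ, blk_succ_zero, blk_succ_succ, cov4_zero, cov4_succ, dot3, Pi.add_apply,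
      Pi.smul_apply, smul_eq_mul]
    simp
    ring
  have hab : dot3 h (a + ε • b) (a + ε • b)
      = dot3 h a a + 2 * ε * dot3 h a b + ε ^ 2 * dot3 h b b := by
    simp only [dot3, Fin.sum_univ_three, Pi.add_apply, Pi.smul_apply, smul_eq_mul,
      hh 1 0, hh 2 0, hh 2 1]
    ring
  rw [key, hab, ← ha, ← hb]
  ring

/-- The spatial part of `𝓘^{(0,ε)}`, written without reference to the time direction. -/
lemma I12_spatial (hA : ∀ i j, A i j = A j i) (hB : ∀ i j, B i j = B j i)
    (hh : ∀ i j, h i j = h j i) :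
    let x := contract h a
    let y := contract h b
    let u := contract A y
    let v := contract B x
    let m := contract B (contract h u)
    let n := contract A (contract h v)
    let w := wbar a b ε
    let D := dotMat h A B
    (fun i j : Fin 3 => I12 h A B a b ε i.succ j.succ) =
      (-(1 / 4) * (x ⬝ᵥ v)) • A + (-(1 / 4) * (y ⬝ᵥ u)) • B
      + (-(ε / 4)) • symOuter a m + (-(ε / 4)) • symOuter b n
      + (ε * D / 8) • symOuter a b + (ε / 4) • symOuter u v
      + (-(ε * (dot3 h a b - nrm3 h a * nrm3 h b) / 4)) • symComp h A B
      + (-(D / 8)) • symOuter w w + (1 / 4 : ℝ) • symOuter w n + (ε / 4) • symOuter w m := by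
  intro x y u v m n w D
  have hvec (c : Fin 3 → ℝ) (i : Fin 3) :
      vecOf (bigH h) (ell h c) i.succ = -contract h c i := by
    simp [vecOf, bigH, ell, contract, sum_fin_four_eq_zero_add_succ, blk_succ_zero,
      blk_succ_succ, cov4_succ]
  have hD : dotg (bigH h) (ext0 A) (ext0 B) = D := by
    simp [dotg, bigH, ext0, D, dotMat, sum_fin_four_eq_zero_add_succ, blk_zero_zero,
      blk_succ_zero, blk_zero_succ, blk_succ_succ]
  have hM (P Q : Fin 3 → Fin 3 → ℝ) (hP : ∀ i j, P i j = P j i) (hQ : ∀ i j, Q i j = Q j i)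
      (c : Fin 3 → ℝ) (j : Fin 3) :
      Mop (bigH h) (ext0 P) (ext0 Q) (vecOf (bigH h) (ell h c)) j.succ
        = -contract Q (contract h (contract P (contract h c))) j := by
    simp only [Mop, sum_fin_four_eq_zero_add_succ, hvec]
    simp only [ext0, bigH, blk_zero_succ, blk_succ_zero, blk_succ_succ, mul_zero, zero_mul,
      Finset.sum_const_zero, add_zero, zero_add]
    generalize contract h c = z
    simp only [contract, Fin.sum_univ_three, hP 1 0, hP 2 0, hP 2 1, hQ _ j,
      hh 1 0, hh 2 0, hh 2 1]
    ring
  have happ (P : Fin 3 → Fin 3 → ℝ) (c : Fin 3 → ℝ) (i : Fin 3) :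
      app1 (ext0 P) (vecOf (bigH h) (ell h c)) i.succ = -contract P (contract h c) i := by
    simp only [app1, sum_fin_four_eq_zero_add_succ, hvec, ext0, blk_succ_zero, blk_succ_succ]
    simp [contract]
  have happ₂ (P : Fin 3 → Fin 3 → ℝ) (c : Fin 3 → ℝ) :
      app2 (ext0 P) (vecOf (bigH h) (ell h c)) (vecOf (bigH h) (ell h c))
        = contract h c ⬝ᵥ contract P (contract h c) := by
    rw [← dot3_eq_dotProduct]
    simp only [app2, sum_fin_four_eq_zero_add_succ, hvec, ext0, blk_zero_zero,
      blk_succ_zero, blk_zero_succ, blk_succ_succ]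
    simp [dot3]
  have hbil : hBil (bigH h) (ell h a) (ell h b) = dot3 h a b - nrm3 h a * nrm3 h b := by
    simp only [hBil, sum_fin_four_eq_zero_add_succ, ell, bigH, blk_zero_zero,
      blk_succ_zero, blk_zero_succ, blk_succ_succ, cov4_zero, cov4_succ]
    simp [dot3]
    ring
  have hK (i j : Fin 3) : (∑ σ, ∑ ν, bigH h σ ν * (ext0 A i.succ σ * ext0 B ν j.succ
      + ext0 A j.succ σ * ext0 B ν i.succ)) = symComp h A B i j := by
    simp [symComp, bigH, ext0, sum_fin_four_eq_zero_add_succ, blk_succ_zero, blk_zero_succ,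
      blk_succ_succ]
  funext i j
  simp only [I12, Icor, P0, Jcov, hD, hM A B hA hB, hM B A hB hA, happ, happ₂, hbil, hK,
    Pi.add_apply, Pi.smul_apply, smul_eq_mul, symOuter, w, wbar]
  simp only [ell, cov4_succ, ext0, blk_succ_succ]
  ring

/-- The trace of the spatial part of `𝓘^{(0,ε)}` minus its component along `w̄`. -/
lemma trH_sub_quadN_I12 (hh : ∀ i j, h i j = h j i)
    (hA : ∀ i j, A i j = A j i) (hB : ∀ i j, B i j = B j i)
    (hA_tr : trH h A = 0) (hB_tr : trH h B = 0)
    (hA_trans : contract A (contract h a) = 0) (hB_trans : contract B (contract h b) = 0)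
    (ha : nrm3 h a ^ 2 = dot3 h a a) (hb : nrm3 h b ^ 2 = dot3 h b b) (hε : ε ^ 2 = 1) :
    dot3 h (wbar a b ε) (wbar a b ε) *
        trH h (fun i j : Fin 3 => I12 h A B a b ε i.succ j.succ)
      - quadN (contract h (wbar a b ε)) (fun i j : Fin 3 => I12 h A B a b ε i.succ j.succ)
    = -(ε * (dot3 h a b - nrm3 h a * nrm3 h b) / 4) *
      (dotMat h A B * (2 * nrm3 h a ^ 2 + 2 * nrm3 h b ^ 2 + 3 * ε * dot3 h a b
          - ε * nrm3 h a * nrm3 h b)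
        - 2 * ε * dot3 h (contract A (contract h b)) (contract B (contract h a))) := by
  rw [I12_spatial a b ε hA hB hh]
  simp only [trH_add, trH_smul, quadN_add, quadN_smul, trH_symOuter _ _ hh, quadN_symOuter,
    trH_symComp hh hA hB, quadN_symComp _ hA hB, hA_tr, hB_tr]
  have hw : wbar a b ε = a + ε • b := rfl
  have hz : contract h (wbar a b ε) = contract h a + ε • contract h b := by
    rw [hw, contract_add_smul]
  have hAz : contract A (contract h (wbar a b ε)) = ε • contract A (contract h b) := by
    rw [hz, contract_add_smul, hA_trans, zero_add]
  have hBz : contract B (contract h (wbar a b ε)) = contract B (contract h a) := by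
    rw [hz, contract_add_smul, hB_trans, smul_zero, add_zero]
  set x := contract h a with hx
  set y := contract h b with hy
  set u := contract A y with hu
  set v := contract B x with hv
  set E := dot3 h u v with hE
  have hxu : x ⬝ᵥ u = 0 := by rw [hu, dotProduct_contract_comm _ _ hA, hA_trans]; simp
  have hyv : y ⬝ᵥ v = 0 := by rw [hv, dotProduct_contract_comm _ _ hB, hB_trans]; simp
  have hxm : x ⬝ᵥ contract B (contract h u) = E := by
    rw [dotProduct_contract_comm _ _ hB, hE, dot3_eq_contract_dotProduct _ _ hh]
  have hym : y ⬝ᵥ contract B (contract h u) = 0 := by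
    rw [dotProduct_contract_comm _ _ hB, hB_trans]; simp
  have hxn : x ⬝ᵥ contract A (contract h v) = 0 := by
    rw [dotProduct_contract_comm _ _ hA, hA_trans]; simp
  have hyn : y ⬝ᵥ contract A (contract h v) = E := by
    rw [dotProduct_contract_comm _ _ hA, hE, dotProduct_comm, ← dot3_eq_dotProduct]
  have hxa : x ⬝ᵥ a = dot3 h a a := (dot3_eq_contract_dotProduct _ _ hh).symm
  have hxb : x ⬝ᵥ b = dot3 h a b := (dot3_eq_contract_dotProduct _ _ hh).symm
  have hya : y ⬝ᵥ a = dot3 h a b := by rw [dot3_comm a b hh, dot3_eq_contract_dotProduct _ _ hh]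
  have hyb : y ⬝ᵥ b = dot3 h b b := (dot3_eq_contract_dotProduct _ _ hh).symm
  have hEsmul : dot3 h (ε • u) v = ε * E := by
    rw [hE, dot3_eq_dotProduct, dot3_eq_dotProduct, smul_dotProduct, smul_eq_mul]
  simp only [quadN_eq_dotProduct, hAz, hBz, hEsmul]
  simp only [dot3_eq_contract_dotProduct _ _ hh, hz]
  simp only [hw, ← hx, ← hy, dotProduct_add, add_dotProduct, dotProduct_smul, smul_dotProduct,
    smul_eq_mul, hxu, hyv, hxm, hym, hxn, hyn, hxa, hxb, hya, hyb, ← ha, ← hb]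
  generalize dot3 h a b = p
  generalize dotMat h A B = D
  generalize nrm3 h a = α
  generalize nrm3 h b = β
  generalize x ⬝ᵥ v = s
  generalize y ⬝ᵥ u = t
  rcases sq_eq_one_iff.mp hε with rfl | rfl <;> ring

end Spatial

/-- the spatial part of the mixed-harmonic corrector `F^{(2,ε)} = −𝓘/𝐡(w,w)`
decomposes as `P̄¹_{N_w}(γ) + 4 φ̂^{(2,ε)} g` with `γ := F^{(2,ε)}_{spatial} − 4 φ̂^{(2,ε)} g`;
equivalently `tr γ = γ_{N_w N_w}`, i.e. `P̄¹_{N_w}(γ) = γ`. -/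
theorem statement12
    (g h : Fin 3 → Fin 3 → ℝ)
    (hg_symm : ∀ i j, g i j = g j i)
    (hg_pos : ∀ ξ : Fin 3 → ℝ, ξ ≠ 0 → 0 < ∑ i, ∑ j, g i j * ξ i * ξ j)
    (h_inv₁ : ∀ i j, (∑ k, g i k * h k j) = if i = j then (1 : ℝ) else 0)
    (h_inv₂ : ∀ i j, (∑ k, h i k * g k j) = if i = j then (1 : ℝ) else 0)
    (ωA ωB : Fin 3 → ℝ) (hωA : ωA ≠ 0) (hωB : ωB ≠ 0)
    (ε : ℝ) (hε : ε = 1 ∨ ε = -1)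
    (FbA FbB : Fin 3 → Fin 3 → ℝ)
    (hFbA_symm : ∀ i j, FbA i j = FbA j i) (hFbB_symm : ∀ i j, FbB i j = FbB j i)
    (hFbA_tr : (∑ i, ∑ j, h i j * FbA i j) = 0)
    (hFbB_tr : (∑ i, ∑ j, h i j * FbB i j) = 0)
    (hFbA_trans : ∀ i, (∑ j, ∑ k, FbA i j * h j k * ωA k) = 0)
    (hFbB_trans : ∀ i, (∑ j, ∑ k, FbB i j * h j k * ωB k) = 0)
    (hw_ne : wbar ωA ωB ε ≠ 0)
    (hang : (∑ i, ∑ j, h i j * ωA i * ωB j) ≠ nrm3 h ωA * nrm3 h ωB) :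
    trH h (gam g h FbA FbB ωA ωB ε)
        = quadN (Nw h ωA ωB ε) (gam g h FbA FbB ωA ωB ε)
    ∧ (∀ i j, P1 g h (Nw h ωA ωB ε) (gam g h FbA FbB ωA ωB ε) i j
        = gam g h FbA FbB ωA ωB ε i j)
    ∧ (∀ i j, -(I12 h FbA FbB ωA ωB ε i.succ j.succ) / Hww h ωA ωB ε
        = P1 g h (Nw h ωA ωB ε) (gam g h FbA FbB ωA ωB ε) i j
          + 4 * phi2 h FbA FbB ωA ωB ε * g i j) := by
  have hh := inv_symm hg_symm h_inv₁
  have hpos {x : Fin 3 → ℝ} (hx : x ≠ 0) := dot3_self_pos hg_symm hg_pos h_inv₁ hx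
  have hA := nrm3_sq (hpos hωA)
  have hB := nrm3_sq (hpos hωB)
  have hW := nrm3_sq (hpos hw_ne)
  have hW0 : dot3 h (wbar ωA ωB ε) (wbar ωA ωB ε) ≠ 0 := (hpos hw_ne).ne'
  have hε2 : ε ^ 2 = 1 := by rcases hε with rfl | rfl <;> norm_num
  have hε0 : ε ≠ 0 := by rcases hε with rfl | rfl <;> norm_num
  have hcov (F : Fin 3 → Fin 3 → ℝ) (ω : Fin 3 → ℝ) (i : Fin 3) :
      contract F (contract h ω) i = ∑ j, ∑ k, F i j * h j k * ω k := by
    simp only [contract, Finset.mul_sum, mul_assoc]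
  have hdiff := trH_sub_quadN_I12 ωA ωB ε hh hFbA_symm hFbB_symm hFbA_tr hFbB_tr
    (funext fun i => (hcov _ _ i).trans (hFbA_trans i))
    (funext fun i => (hcov _ _ i).trans (hFbB_trans i)) hA hB hε2
  have hHww := Hww_eq ωA ωB ε hA hB hh
  have hp : dot3 h ωA ωB - nrm3 h ωA * nrm3 h ωB ≠ 0 := sub_ne_zero.mpr hang
  have hE : (∑ i, ∑ b, ∑ c, ∑ j, ∑ d, ∑ e,
      FbA i b * h b c * ωB c * h i j * FbB j d * h d e * ωA e)
      = dot3 h (contract FbA (contract h ωB)) (contract FbB (contract h ωA)) := by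
    simp only [dot3, hcov]
    refine Finset.sum_congr rfl fun i _ => ?_
    calc _ = (∑ b, ∑ c, FbA i b * h b c * ωB c)
          * ∑ j, h i j * ∑ d, ∑ e, FbB j d * h d e * ωA e := by
            simp only [Finset.sum_mul]
            simp only [Finset.mul_sum, mul_assoc]
      _ = _ := by
            rw [Finset.mul_sum]
            exact Finset.sum_congr rfl fun j _ => by ring
  have hphi : phi2 h FbA FbB ωA ωB ε * (64 * dot3 h (wbar ωA ωB ε) (wbar ωA ωB ε))
      = dotMat h FbA FbB * (2 * nrm3 h ωA ^ 2 + 2 * nrm3 h ωB ^ 2 + 3 * ε * dot3 h ωA ωB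
          - ε * nrm3 h ωA * nrm3 h ωB)
        - 2 * ε * dot3 h (contract FbA (contract h ωB)) (contract FbB (contract h ωA)) := by
    rw [phi2, hE, hW, ← dotMat]
    field_simp
    ring
  set I : Fin 3 → Fin 3 → ℝ := fun i j => I12 h FbA FbB ωA ωB ε i.succ j.succ with hI
  set φ := phi2 h FbA FbB ωA ωB ε
  have hgam : gam g h FbA FbB ωA ωB ε = (-(1 / Hww h ωA ωB ε)) • I + (-(4 * φ)) • g := by
    funext i j
    simp only [gam, hI, Pi.add_apply, Pi.smul_apply, smul_eq_mul]
    ring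
  have htr_g : trH h g = 3 := by
    have (i : Fin 3) : ∑ j, h i j * g i j = 1 := by
      simpa [hg_symm _ i] using h_inv₂ i i
    simp [trH, this]
  have hquad_g : quadN (contract h (wbar ωA ωB ε)) g
      = dot3 h (wbar ωA ωB ε) (wbar ωA ωB ε) := by
    rw [quadN_eq_dotProduct, contract_contract_of_inv h_inv₁,
      dot3_eq_contract_dotProduct _ _ hh]
  have hN : quadN (Nw h ωA ωB ε) (gam g h FbA FbB ωA ωB ε)
      = quadN (contract h (wbar ωA ωB ε)) (gam g h FbA FbB ωA ωB ε)
        / dot3 h (wbar ωA ωB ε) (wbar ωA ωB ε) := by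
    rw [← hW, ← quadN_div]
    rfl
  have htr : trH h (gam g h FbA FbB ωA ωB ε)
      = quadN (Nw h ωA ωB ε) (gam g h FbA FbB ωA ωB ε) := by
    rw [hN, eq_div_iff hW0, hgam, trH_add, trH_smul, trH_smul, quadN_add, quadN_smul,
      quadN_smul, htr_g, hquad_g, hHww]
    rw [← hphi] at hdiff
    field_simp
    linear_combination (-1 : ℝ) * hdiff
  have hP (i j : Fin 3) : P1 g h (Nw h ωA ωB ε) (gam g h FbA FbB ωA ωB ε) i j
      = gam g h FbA FbB ωA ωB ε i j := by
    simp [P1, htr]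
  refine ⟨htr, hP, fun i j => ?_⟩
  rw [hP, gam]
  ring
end
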